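/- arXiv:math/0606109 — 2 statements merged into one kernel-verified Lean document; each statement's English description precedes it below -/
import Mathlib

section
/- Let O be a Dedekind domain with fraction field k. For any nonzero fractional ideals a, b, c of O, there exist elements x, y in k such that x·a + y·b = c. -/
/-- Let `O` be a Dedekind domain with fraction field `k`. For any nonzero fractional ideals
`a`, `b`, `c` of `O` there exist `x, y ∈ k` with `x·a + y·b = c`. -/
theorem exists_smul_add_smul_eq_fractionalIdeal
    (O k : Type*) [CommRing O] [IsDedekindDomain O] [Field k] [Algebra O k]
    [IsFractionRing O k]
    (a b c : FractionalIdeal (nonZeroDivisors O) k)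
    (ha : a ≠ 0) (hb : b ≠ 0) (hc : c ≠ 0) :
    ∃ x y : k,
      FractionalIdeal.spanSingleton (nonZeroDivisors O) x * a +
        FractionalIdeal.spanSingleton (nonZeroDivisors O) y * b = c := by
  obtain ⟨x, hx, hx0⟩ : ∃ x ∈ c * a⁻¹, x ≠ 0 := by
    by_contra! h
    exact mul_ne_zero hc (inv_ne_zero ha) (FractionalIdeal.eq_zero_iff.mpr h)
  have hle : FractionalIdeal.spanSingleton (nonZeroDivisors O) x * a ≤ c := by
    calc FractionalIdeal.spanSingleton (nonZeroDivisors O) x * a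
        ≤ c * a⁻¹ * a := by
          gcongr
          exact FractionalIdeal.spanSingleton_le_iff_mem.mpr hx
      _ = c := inv_mul_cancel_right₀ ha c
  exact ⟨x, IsDedekindDomain.exists_add_spanSingleton_mul_eq hle
    (mul_ne_zero (FractionalIdeal.spanSingleton_ne_zero_iff.mpr hx0) ha) hb⟩
end

section
/- Let K be a non-archimedean local field with ring of integers O, uniformizer π, residue cardinality q. For the split orbit, the local zeta integral 𝔛(s₁,s₂) = ∫_{(K^×)³×K} |t₁|^{s₁+2s₂}|t₂t₃|^{s₁} · 1_{O}(t₁)1_{O}(t₁u)1_{O}(t₂−ut₃)1_{O}(t₃) d^×t₁ d^×t₂ d^×t₃ du equals (1−q^{-2s₂})^{-1}(1−q^{1−2s₁−2s₂})^{-1}(1−q^{-s₁−2s₂})^{-1} · (1−q^{-s₁-2s₂})²/(1−q^{-s₁})², for Re(s₁), Re(s₂) sufficiently large, where d^×t gives O^× volume 1 and du gives O volume 1. -/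
open MeasureTheory
open scoped Classical

section Measure

variable {K : Type*} [NormedField K] [MeasurableSpace K] [BorelSpace K]

/-- If `ν` gives mass one to the unit shell and is invariant under multiplication, each shell
has mass one. -/
lemma measure_shell_eq_one {q : ℕ} {ν : Measure K}
    (hνinv : ∀ a : K, a ≠ 0 → Measure.map (fun x => a * x) ν = ν)
    (hνO : ν {x : K | ‖x‖ = 1} = 1)
    (hsurj : ∀ n : ℤ, ∃ x : K, x ≠ 0 ∧ ‖x‖ = (q : ℝ) ^ n) (n : ℤ) :
    ν {x : K | ‖x‖ = (q : ℝ) ^ n} = 1 := by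
  obtain ⟨y, hy0, hy⟩ := hsurj n
  have hmeas : MeasurableSet {x : K | ‖x‖ = (q : ℝ) ^ n} :=
    (isClosed_eq continuous_norm continuous_const).measurableSet
  rw [← hνinv y hy0, Measure.map_apply (continuous_const_mul y).measurable hmeas, ← hνO]
  congr 1
  ext x
  have : 0 < ‖y‖ := norm_pos_iff.2 hy0
  simp [← hy, this.ne']

/-- The integral of a function of the norm is a sum over the value group. -/
lemma integral_eq_tsum_of_norm_eq_zpow {q : ℕ} (hq : 1 < q) {ν : Measure K}
    (hval : ∀ x : K, x ≠ 0 → ∃ n : ℤ, ‖x‖ = (q : ℝ) ^ n)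
    (hshell : ∀ n : ℤ, ν {x : K | ‖x‖ = (q : ℝ) ^ n} = 1) (hν0 : ν {(0 : K)} = 0)
    {F : K → ℝ} {g : ℤ → ℝ} (hF : ∀ x n, ‖x‖ = (q : ℝ) ^ n → F x = g n) :
    ∫ x, F x ∂ν = ∑' n, g n := by
  have hq0 : (0 : ℝ) < q := by positivity
  set N : K → ℤ := fun x => Int.log q ‖x‖ with hN
  have hNval : ∀ x n, ‖x‖ = (q : ℝ) ^ n → N x = n := fun x n h => by
    simp only [hN, h, Int.log_zpow hq]
  have hNspec : ∀ x, x ≠ 0 → ‖x‖ = (q : ℝ) ^ N x := fun x hx => by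
    obtain ⟨n, hn⟩ := hval x hx
    rw [hNval x n hn, hn]
  have hshellm (n : ℤ) : MeasurableSet {x : K | ‖x‖ = (q : ℝ) ^ n} :=
    (isClosed_eq continuous_norm continuous_const).measurableSet
  have hpre (n : ℤ) : N ⁻¹' {n} =
      {x : K | ‖x‖ = (q : ℝ) ^ n} ∪ (if n = 0 then {0} else ∅) := by
    ext x
    by_cases hx : x = 0
    · subst hx
      have h0 : (0 : ℝ) ≠ (q : ℝ) ^ n := (zpow_pos hq0 n).ne
      by_cases hn : n = 0 <;> simp [hN, hn, h0, eq_comm (a := (0 : ℤ))]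
    · have : x ∉ (if n = 0 then {0} else ∅ : Set K) := by split_ifs <;> simp [hx]
      simp only [Set.mem_preimage, Set.mem_singleton_iff, Set.mem_union, this, or_false,
        Set.mem_ofPred_eq]
      exact ⟨fun h => h ▸ hNspec x hx, hNval x n⟩
  have hNm : Measurable N := measurable_to_countable' fun n => by
    rw [hpre]
    refine (hshellm n).union ?_
    split_ifs
    · exact measurableSet_singleton 0
    · exact MeasurableSet.empty
  have hmap : ν.map N = Measure.count := Measure.ext_of_singleton fun n => by
    rw [Measure.map_apply hNm (measurableSet_singleton n), hpre, Measure.count_singleton,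
      measure_congr (union_ae_eq_left_of_ae_eq_empty ?_), hshell]
    split_ifs <;> simp [hν0]
  have hae : ∀ᵐ x ∂ν, F x = g (N x) := by
    have h0 : ∀ᵐ x ∂ν, x ≠ 0 := by simpa [ae_iff] using hν0
    filter_upwards [h0] with x hx using hF x _ (hNspec x hx)
  rw [integral_congr_ae hae,
    ← integral_map (f := g) hNm.aemeasurable (by fun_prop), hmap]
  by_cases hg : Summable g
  · rw [integral_countable (integrable_count_iff.2 hg.norm)]
    simp [Measure.real]
  · rw [tsum_eq_zero_of_not_summable hg, integral_undef]
    rw [integrable_count_iff]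
    exact fun h => hg h.of_norm

/-- The mass of a ball of radius `q ^ n` is `q ^ n`. -/
lemma measure_ball_eq_pow {q : ℕ} (hq : 1 < q)
    (hultra : ∀ x y : K, ‖x + y‖ ≤ max ‖x‖ ‖y‖)
    (hval : ∀ x : K, x ≠ 0 → ∃ n : ℤ, ‖x‖ = (q : ℝ) ^ n)
    (hsurj : ∀ n : ℤ, ∃ x : K, x ≠ 0 ∧ ‖x‖ = (q : ℝ) ^ n)
    {μ : Measure K}
    (hμinv : ∀ a : K, Measure.map (fun x => a + x) μ = μ)
    (hμO : μ {x : K | ‖x‖ ≤ 1} = 1)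
    (hres : ∃ S : Finset K, S.card = q ∧ (∀ x : K, ‖x‖ ≤ 1 → ∃ s ∈ S, ‖x - s‖ < 1) ∧
      ∀ s ∈ S, ∀ t ∈ S, s ≠ t → ‖s - t‖ = 1) (n : ℕ) (c : K) :
    μ {x : K | ‖x - c‖ ≤ (q : ℝ) ^ n} = (q : ENNReal) ^ n := by
  have hq0 : (0 : ℝ) < q := by positivity
  have hq1 : (1 : ℝ) < q := by exact_mod_cast hq
  have hm (c : K) (r : ℝ) : MeasurableSet {x : K | ‖x - c‖ ≤ r} :=
    (isClosed_le (by fun_prop) continuous_const).measurableSet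
  have htrans (c : K) (r : ℝ) : μ {x : K | ‖x - c‖ ≤ r} = μ {x : K | ‖x‖ ≤ r} := by
    conv_lhs => rw [← hμinv c, Measure.map_apply (continuous_const_add c).measurable (hm c r)]
    simp
  rw [htrans]
  induction n with
  | zero => simpa using hμO
  | succ n ih =>
    obtain ⟨S, hcard, hcov, hsep⟩ := hres
    have hS : ∀ s ∈ S, ‖s‖ ≤ 1 := fun s hs => by
      obtain ⟨t, ht, ht1⟩ := hcov 0 (by simp)
      rw [zero_sub, norm_neg] at ht1
      by_cases hst : s = t
      · exact hst ▸ ht1.le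
      · calc ‖s‖ = ‖(s - t) + t‖ := by simp
          _ ≤ _ := hultra _ _
          _ ≤ 1 := max_le (hsep s hs t ht hst).le ht1.le
    obtain ⟨y, hy0, hy⟩ := hsurj (n + 1 : ℕ)
    rw [zpow_natCast] at hy
    have hypos : 0 < ‖y‖ := norm_pos_iff.2 hy0
    have hlt : (q : ℝ) ^ n < (q : ℝ) ^ (n + 1) := pow_lt_pow_right₀ hq1 n.lt_succ_self
    have hdisc (x : K) (hx : ‖x‖ < (q : ℝ) ^ (n + 1)) : ‖x‖ ≤ (q : ℝ) ^ n := by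
      by_cases hx0 : x = 0
      · simp [hx0]
      · obtain ⟨m, hm⟩ := hval x hx0
        rw [hm, ← zpow_natCast] at hx
        rw [hm, ← zpow_natCast]
        have := (zpow_lt_zpow_iff_right₀ hq1).1 hx
        exact (zpow_le_zpow_iff_right₀ hq1).2 (by push_cast at this; lia)
    have hunion : {x : K | ‖x‖ ≤ (q : ℝ) ^ (n + 1)} =
        ⋃ s ∈ S, {x : K | ‖x - y * s‖ ≤ (q : ℝ) ^ n} := by
      ext x
      simp only [Set.mem_ofPred_eq, Set.mem_iUnion, exists_prop]
      constructor
      · intro hx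
        obtain ⟨s, hs, hxs⟩ := hcov (x / y) (by
          rw [norm_div, hy]; exact div_le_one_of_le₀ hx (by positivity))
        refine ⟨s, hs, hdisc _ ?_⟩
        rw [show x - y * s = y * (x / y - s) by field_simp, norm_mul, ← hy]
        exact mul_lt_of_lt_one_right hypos hxs
      · rintro ⟨s, hs, hxs⟩
        calc ‖x‖ = ‖(x - y * s) + y * s‖ := by simp
          _ ≤ _ := hultra _ _
          _ ≤ _ := max_le (hxs.trans hlt.le) (by
            rw [norm_mul, ← hy]; exact mul_le_of_le_one_right hypos.le (hS s hs))
    have hdisj : (S : Set K).PairwiseDisjoint fun s => {x : K | ‖x - y * s‖ ≤ (q : ℝ) ^ n} := by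
      intro s hs t ht hst
      refine Set.disjoint_left.2 fun x (hx : ‖_‖ ≤ _) (hx' : ‖_‖ ≤ _) => ?_
      have h1 : ‖y * (s - t)‖ = (q : ℝ) ^ (n + 1) := by
        rw [norm_mul, hsep s hs t ht hst, hy, mul_one]
      have h2 : ‖y * (s - t)‖ ≤ (q : ℝ) ^ n := by
        calc ‖y * (s - t)‖ = ‖(x - y * t) + -(x - y * s)‖ := by congr 1; ring
          _ ≤ _ := hultra _ _
          _ ≤ _ := max_le hx' (by rwa [norm_neg])
      linarith
    rw [hunion, measure_biUnion_finset hdisj fun s _ => hm _ _]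
    simp only [htrans, ih, Finset.sum_const, hcard, nsmul_eq_mul, pow_succ']

/-- The integral of a constant over the intersection of two balls: in an ultrametric field
they meet in the smaller one or not at all. -/
lemma integral_two_balls {q : ℕ} (hq : 1 < q)
    (hultra : ∀ x y : K, ‖x + y‖ ≤ max ‖x‖ ‖y‖) {μ : Measure K}
    (hball : ∀ (n : ℕ) (c : K), μ {x : K | ‖x - c‖ ≤ (q : ℝ) ^ n} = (q : ENNReal) ^ n)
    (m n : ℕ) (c : K) (C : ℝ) :
    ∫ u, (if ‖u‖ ≤ (q : ℝ) ^ m ∧ ‖u - c‖ ≤ (q : ℝ) ^ n then C else 0) ∂μ =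
      if ‖c‖ ≤ (q : ℝ) ^ max m n then (q : ℝ) ^ min m n * C else 0 := by
  have hq1 : (1 : ℝ) ≤ q := by exact_mod_cast hq.le
  have htri {x y : K} {r : ℝ} (hx : ‖x‖ ≤ r) (hy : ‖y‖ ≤ r) : ‖x + y‖ ≤ r :=
    (hultra x y).trans (max_le hx hy)
  have hsingle (k : ℕ) (d : K) :
      ∫ u, (if ‖u - d‖ ≤ (q : ℝ) ^ k then C else 0) ∂μ = (q : ℝ) ^ k * C := by
    have hm : MeasurableSet {x : K | ‖x - d‖ ≤ (q : ℝ) ^ k} :=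
      (isClosed_le (by fun_prop) continuous_const).measurableSet
    have := integral_indicator_const (μ := μ) C hm
    rw [Measure.real, hball] at this
    simpa [Set.indicator_apply] using this
  split_ifs with h
  · rcases le_total m n with hmn | hmn
    · rw [min_eq_left hmn, ← hsingle m 0]
      rw [max_eq_right hmn] at h
      refine integral_congr_ae (.of_forall fun u => ?_)
      have hle := pow_le_pow_right₀ hq1 hmn
      refine if_congr ⟨fun hu => by simpa using hu.1, fun hu => ?_⟩ rfl rfl
      rw [sub_zero] at hu
      exact ⟨hu, sub_eq_add_neg u c ▸ htri (hu.trans hle) (by rwa [norm_neg])⟩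
    · rw [min_eq_right hmn, ← hsingle n c]
      rw [max_eq_left hmn] at h
      refine integral_congr_ae (.of_forall fun u => ?_)
      have hle := pow_le_pow_right₀ hq1 hmn
      refine if_congr ⟨fun hu => hu.2, fun hu => ⟨?_, hu⟩⟩ rfl rfl
      simpa using htri (hu.trans hle) h
  · refine integral_eq_zero_of_ae (.of_forall fun u => if_neg fun hu => h ?_)
    have h1 := hu.1.trans (pow_le_pow_right₀ hq1 (le_max_left m n))
    have h2 := hu.2.trans (pow_le_pow_right₀ hq1 (le_max_right m n))
    simpa using htri h1 (show ‖-(u - c)‖ ≤ _ by rwa [norm_neg])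

end Measure

section Series

lemma HasSum.of_eq {f g : ℕ → ℝ} {a b : ℝ} (h : HasSum f a) (hfg : ∀ n, g n = f n)
    (hab : b = a) : HasSum g b := by
  rwa [funext hfg, hab]

/-- A sum over the integers of a function supported on `(-∞, N]`. -/
lemma hasSum_int_of_support_le {f : ℤ → ℝ} {s : ℝ} (N : ℤ) (h0 : ∀ n, N < n → f n = 0)
    (h : HasSum (fun b : ℕ => f (N - b)) s) : HasSum f s := by
  have hinj : Function.Injective fun b : ℕ => N - (b : ℤ) := fun a b hab => by
    simp only at hab; lia
  refine (hinj.hasSum_iff fun n hn => h0 n ?_).1 h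
  by_contra! hle
  exact hn ⟨(N - n).toNat, by simp only; lia⟩

/-- The shell-by-shell value of the local zeta integrand. -/
noncomputable def shellTerm (Q A X : ℝ) (α β γ : ℤ) : ℝ :=
  if α ≤ 0 ∧ γ ≤ 0 ∧ β - γ ≤ max (-α) (-γ) then
    Q ^ min (-α) (-γ) * (A ^ (-α) * X ^ (-β - γ)) else 0

variable {Q A X : ℝ}

lemma hasSum_shellTerm_middle (hX0 : 0 < X) (hX1 : X < 1) (a c : ℕ) :
    HasSum (fun β => shellTerm Q A X (-a) β (-c))
      (Q ^ min a c * A ^ a * X ^ c * X⁻¹ ^ (a - c) * (1 - X)⁻¹) := by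
  refine hasSum_int_of_support_le ((a - c : ℕ) : ℤ) (fun n hn => if_neg (by lia)) ?_
  refine ((hasSum_geometric_of_lt_one hX0.le hX1).mul_left
    (Q ^ min a c * A ^ a * X ^ c * X⁻¹ ^ (a - c))).of_eq (fun b => ?_) rfl
  rw [shellTerm, if_pos (by lia)]
  have h1 : min (- -(a : ℤ)) (- -(c : ℤ)) = (min a c : ℕ) := by simp
  have h2 : -(((a - c : ℕ) : ℤ) - b) - -(c : ℤ) = (b + c : ℕ) - ((a - c : ℕ) : ℤ) := by
    push_cast; ring
  rw [h1, h2, neg_neg, zpow_sub₀ hX0.ne']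
  simp only [zpow_natCast, pow_add, inv_pow]
  field_simp

lemma hasSum_shellTerm_right (hX0 : 0 < X) (hX1 : X < 1) (hQX : Q * X ^ 2 ≠ 1) (a : ℕ) :
    HasSum (fun c : ℕ => Q ^ min a c * A ^ a * X ^ c * X⁻¹ ^ (a - c) * (1 - X)⁻¹)
      (((A / X) ^ a * ((1 - (Q * X ^ 2) ^ a) / (1 - Q * X ^ 2)) +
        (Q * A * X) ^ a * (1 - X)⁻¹) * (1 - X)⁻¹) := by
  refine HasSum.mul_right _ ?_
  rw [add_comm]
  have hfin : (A / X) ^ a * ((1 - (Q * X ^ 2) ^ a) / (1 - Q * X ^ 2)) =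
      ∑ c ∈ Finset.range a, Q ^ min a c * A ^ a * X ^ c * X⁻¹ ^ (a - c) := by
    rw [← neg_div_neg_eq (1 - _), neg_sub, neg_sub, ← geom_sum_eq hQX, Finset.mul_sum]
    refine Finset.sum_congr rfl fun c hc => ?_
    obtain ⟨d, rfl⟩ := Nat.exists_eq_add_of_lt (Finset.mem_range.1 hc)
    rw [min_eq_right (by lia), show c + d + 1 - c = d + 1 by lia]
    simp only [pow_add, mul_pow, div_pow, inv_pow, pow_one]
    field_simp
    ring
  rw [hfin, ← hasSum_nat_add_iff]
  refine ((hasSum_geometric_of_lt_one hX0.le hX1).mul_left ((Q * A * X) ^ a)).of_eq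
    (fun e => ?_) rfl
  rw [min_eq_left (by lia), show a - (e + a) = 0 by lia]
  ring

lemma tsum_shellTerm_inner (hQ : 0 ≤ Q) (hA : 0 ≤ A) (hX0 : 0 < X) (hX1 : X < 1)
    (hQX : Q * X ^ 2 ≠ 1) (a : ℕ) :
    ∑' β, ∑' γ, shellTerm Q A X (-a) β γ =
      ((A / X) ^ a * ((1 - (Q * X ^ 2) ^ a) / (1 - Q * X ^ 2)) +
        (Q * A * X) ^ a * (1 - X)⁻¹) * (1 - X)⁻¹ := by
  have hzero (γ : ℤ) (hγ : 0 < γ) (β : ℤ) : shellTerm Q A X (-a) β γ = 0 :=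
    if_neg (by lia)
  have houter : HasSum (fun γ => ∑' β, shellTerm Q A X (-a) β γ) _ :=
    hasSum_int_of_support_le 0 (fun γ hγ => by simp [hzero γ hγ]) <| by
      simpa only [zero_sub, (hasSum_shellTerm_middle hX0 hX1 a _).tsum_eq] using
        hasSum_shellTerm_right (A := A) hX0 hX1 hQX a
  have hsum : Summable (Function.uncurry fun γ β => shellTerm Q A X (-a) β γ) := by
    refine (summable_prod_of_nonneg ?_).2 ⟨fun γ => ?_, houter.summable⟩
    · rintro ⟨γ, β⟩
      simp only [Function.uncurry, shellTerm, Pi.zero_apply]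
      split_ifs <;> positivity
    · rcases le_or_gt γ 0 with hγ | hγ
      · obtain ⟨c, rfl⟩ : ∃ c : ℕ, γ = -c := ⟨(-γ).toNat, by lia⟩
        exact (hasSum_shellTerm_middle hX0 hX1 a c).summable
      · simp [Function.uncurry, hzero γ hγ]
  rw [hsum.tsum_comm]
  exact houter.tsum_eq

lemma tsum_shellTerm (hQ : 0 ≤ Q) (hA : 0 ≤ A) (hX0 : 0 < X) (hX1 : X < 1)
    (hAX : A < X) (hQX : Q * X < 1) :
    ∑' α, ∑' β, ∑' γ, shellTerm Q A X α β γ =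
      (1 - A / X)⁻¹ * (1 - Q * A * X)⁻¹ * (1 - A) / (1 - X) ^ 2 := by
  have hQX2 : Q * X ^ 2 < 1 := by nlinarith
  have hr1 : A / X < 1 := (div_lt_one hX0).2 hAX
  have hr2 : Q * A * X < 1 := by nlinarith
  refine (hasSum_int_of_support_le 0 (fun α hα => ?_) ?_).tsum_eq
  · have (β γ : ℤ) : shellTerm Q A X α β γ = 0 := if_neg (by lia)
    simp [this]
  simp only [zero_sub, tsum_shellTerm_inner hQ hA hX0 hX1 hQX2.ne]
  have g1 := hasSum_geometric_of_lt_one (div_nonneg hA hX0.le) hr1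
  have g2 := hasSum_geometric_of_lt_one (by positivity) hr2
  refine ((((g1.sub g2).div_const (1 - Q * X ^ 2)).add
    (g2.mul_right (1 - X)⁻¹)).mul_right (1 - X)⁻¹).of_eq (fun a => ?_) ?_
  · have : (A / X) ^ a * (Q * X ^ 2) ^ a = (Q * A * X) ^ a := by
      rw [← mul_pow]; congr 1; field_simp
    rw [← this]
    ring
  · have e1 : X - A ≠ 0 := (sub_pos.2 hAX).ne'
    have e2 : 1 - Q * A * X ≠ 0 := (sub_pos.2 hr2).ne'
    have e3 : 1 - X ≠ 0 := (sub_pos.2 hX1).ne'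
    have e4 : 1 - Q * X ^ 2 ≠ 0 := (sub_pos.2 hQX2).ne'
    have e5 : 1 - A / X = (X - A) / X := by field_simp
    rw [e5]
    generalize hD : 1 - Q * A * X = D at e2 ⊢
    generalize hE : 1 - Q * X ^ 2 = E at e4 ⊢
    field_simp
    rw [← hD, ← hE]
    ring

end Series

/-- Explicit local zeta formula at a finite place, split case.  `K` is a non-archimedean
local field with ring of integers `O = {‖x‖ ≤ 1}`, residue cardinality `q`, value group
`q^ℤ`; `μ` is the additive Haar measure with `μ(O) = 1` and `ν` the multiplicative Haar
measure on `K^×` with `ν(O^×) = 1`.  For `s₁, s₂` sufficiently large,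
`∫ |t₁|^{s₁+2s₂}|t₂t₃|^{s₁} 1_O(t₁)1_O(t₁u)1_O(t₂−ut₃)1_O(t₃) d^×t₁d^×t₂d^×t₃du`
equals
`(1−q^{-2s₂})⁻¹(1−q^{1−2s₁−2s₂})⁻¹(1−q^{-s₁−2s₂})⁻¹ · (1−q^{-s₁−2s₂})²/(1−q^{-s₁})²`. -/
theorem local_zeta_split_explicit
    (K : Type*) [NormedField K] [MeasurableSpace K] [BorelSpace K]
    (hultra : ∀ x y : K, ‖x + y‖ ≤ max ‖x‖ ‖y‖)
    (q : ℕ) (hq : 1 < q)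
    (hval : ∀ x : K, x ≠ 0 → ∃ n : ℤ, ‖x‖ = (q : ℝ) ^ n)
    (hsurj : ∀ n : ℤ, ∃ x : K, x ≠ 0 ∧ ‖x‖ = (q : ℝ) ^ n)
    (μ ν : Measure K)
    (hμinv : ∀ a : K, Measure.map (fun x => a + x) μ = μ)
    (hμO : μ {x : K | ‖x‖ ≤ 1} = 1)
    (hres : ∃ S : Finset K, S.card = q ∧ (∀ x : K, ‖x‖ ≤ 1 → ∃ s ∈ S, ‖x - s‖ < 1) ∧
      ∀ s ∈ S, ∀ t ∈ S, s ≠ t → ‖s - t‖ = 1)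
    (hνinv : ∀ a : K, a ≠ 0 → Measure.map (fun x => a * x) ν = ν)
    (hνO : ν {x : K | ‖x‖ = 1} = 1)
    (hν0 : ν {(0 : K)} = 0) :
    ∀ s₁ s₂ : ℝ, 1 < s₁ → 1 < s₂ →
      (∫ t₁, ∫ t₂, ∫ t₃, ∫ u,
          (if ‖t₁‖ ≤ 1 ∧ ‖t₁ * u‖ ≤ 1 ∧ ‖t₂ - u * t₃‖ ≤ 1 ∧ ‖t₃‖ ≤ 1
            then ‖t₁‖ ^ (s₁ + 2 * s₂) * ‖t₂ * t₃‖ ^ s₁ else 0) ∂μ ∂ν ∂ν ∂ν)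
        = (1 - (q : ℝ) ^ (-(2 * s₂)))⁻¹ * (1 - (q : ℝ) ^ (1 - 2 * s₁ - 2 * s₂))⁻¹ *
            (1 - (q : ℝ) ^ (-(s₁ + 2 * s₂)))⁻¹ *
            ((1 - (q : ℝ) ^ (-(s₁ + 2 * s₂))) ^ 2 / (1 - (q : ℝ) ^ (-s₁)) ^ 2) := by
  intro s₁ s₂ hs₁ hs₂
  have hQ1 : (1 : ℝ) < q := by exact_mod_cast hq
  have hQ0 : (0 : ℝ) < q := by positivity
  have hshell := measure_shell_eq_one hνinv hνO hsurj
  have hball := measure_ball_eq_pow hq hultra hval hsurj hμinv hμO hres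
  set A : ℝ := (q : ℝ) ^ (-(s₁ + 2 * s₂)) with hA
  set X : ℝ := (q : ℝ) ^ (-s₁) with hX
  have hpow (n : ℤ) (s : ℝ) : ((q : ℝ) ^ n) ^ s = ((q : ℝ) ^ (-s)) ^ (-n) := by
    rw [← Real.rpow_intCast, ← Real.rpow_intCast, ← Real.rpow_mul hQ0.le, ← Real.rpow_mul hQ0.le]
    congr 1
    push_cast
    ring
  have hX0 : 0 < X := by positivity
  have hA0 : 0 < A := by positivity
  have hX1 : X < 1 := Real.rpow_lt_one_of_one_lt_of_neg hQ1 (by linarith)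
  have hA1 : A < 1 := Real.rpow_lt_one_of_one_lt_of_neg hQ1 (by linarith)
  have hAX : A < X := Real.rpow_lt_rpow_of_exponent_lt hQ1 (by linarith)
  have hQX : q * X < 1 := by
    rw [hX, ← Real.rpow_one_add' hQ0.le (by linarith)]
    exact Real.rpow_lt_one_of_one_lt_of_neg hQ1 (by linarith)
  have hdiv : (q : ℝ) ^ (-(2 * s₂)) = A / X := by
    rw [hA, hX, ← Real.rpow_sub hQ0]
    congr 1
    ring
  have hprod : (q : ℝ) ^ (1 - 2 * s₁ - 2 * s₂) = q * A * X := by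
    rw [hA, hX, mul_assoc, ← Real.rpow_add hQ0, ← Real.rpow_one_add' hQ0.le (by linarith)]
    congr 1
    ring
  have key : (∫ t₁, ∫ t₂, ∫ t₃, ∫ u,
      (if ‖t₁‖ ≤ 1 ∧ ‖t₁ * u‖ ≤ 1 ∧ ‖t₂ - u * t₃‖ ≤ 1 ∧ ‖t₃‖ ≤ 1
        then ‖t₁‖ ^ (s₁ + 2 * s₂) * ‖t₂ * t₃‖ ^ s₁ else 0) ∂μ ∂ν ∂ν ∂ν) =
      ∑' α, ∑' β, ∑' γ, shellTerm q A X α β γ := by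
    refine integral_eq_tsum_of_norm_eq_zpow hq hval hshell hν0 fun t₁ α h₁ =>
      integral_eq_tsum_of_norm_eq_zpow hq hval hshell hν0 fun t₂ β h₂ =>
      integral_eq_tsum_of_norm_eq_zpow hq hval hshell hν0 fun t₃ γ h₃ => ?_
    have hle (n : ℤ) : (q : ℝ) ^ n ≤ 1 ↔ n ≤ 0 := zpow_le_one_iff_right₀ hQ1
    by_cases hαγ : α ≤ 0 ∧ γ ≤ 0
    · obtain ⟨a, rfl⟩ : ∃ a : ℕ, α = -a := ⟨(-α).toNat, by lia⟩
      obtain ⟨c, rfl⟩ : ∃ c : ℕ, γ = -c := ⟨(-γ).toNat, by lia⟩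
      have ht₃ : 0 < ‖t₃‖ := h₃ ▸ zpow_pos hQ0 _
      have ht₃' : t₃ ≠ 0 := norm_pos_iff.1 ht₃
      have hcond (u : K) : (‖t₁‖ ≤ 1 ∧ ‖t₁ * u‖ ≤ 1 ∧ ‖t₂ - u * t₃‖ ≤ 1 ∧ ‖t₃‖ ≤ 1) ↔
          ‖u‖ ≤ (q : ℝ) ^ a ∧ ‖u - t₂ / t₃‖ ≤ (q : ℝ) ^ c := by
        have e : t₂ - u * t₃ = -((u - t₂ / t₃) * t₃) := by field_simp; ring
        rw [e, norm_neg, norm_mul, norm_mul, h₁, h₃, hle, hle, zpow_neg, zpow_neg,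
          zpow_natCast, zpow_natCast, inv_mul_eq_div,
          ← div_eq_mul_inv, div_le_one₀ (by positivity), div_le_one₀ (by positivity)]
        exact ⟨fun h => ⟨h.2.1, h.2.2.1⟩, fun h => ⟨hαγ.1, h.1, h.2, hαγ.2⟩⟩
      simp only [hcond]
      rw [integral_two_balls hq hultra hball, shellTerm, norm_div, h₂, h₃]
      refine if_congr ?_ ?_ rfl
      · rw [← zpow_natCast, ← zpow_sub₀ hQ0.ne', zpow_le_zpow_iff_right₀ hQ1]
        lia
      rw [norm_mul, h₁, h₂, h₃, ← zpow_add₀ hQ0.ne', hpow, hpow, ← zpow_natCast]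
      congr 3 <;> lia
    · rw [shellTerm, if_neg (by tauto)]
      refine integral_eq_zero_of_ae (.of_forall fun u => if_neg fun h => hαγ ?_)
      rw [h₁, h₃, hle, hle] at h
      exact ⟨h.1, h.2.2.2⟩
  rw [key, tsum_shellTerm hQ0.le hA0.le hX0 hX1 hAX hQX, hdiv, hprod]
  have : 1 - A ≠ 0 := (sub_pos.2 hA1).ne'
  field_simp
end
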